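/- arXiv:2201.12949 — 2 statements merged into one kernel-verified Lean document; each statement's English description precedes it below -/
import Mathlib

section
/- Let w be a permutation of {1,…,n} and let i be an index with |w(i) − i| = 1. Then the reflection length decreases by exactly one under the i-th flattening: ℓ_T(fl_i(w)) = ℓ_T(w) − 1. -/
/-- The (Coxeter) length of a permutation: its number of inversions,
i.e. pairs `(a,b)` with `a < b` and `w a > w b`. -/
def invLen {n : ℕ} (w : Equiv.Perm (Fin n)) : ℕ :=
  (Finset.univ.filter (fun p : Fin n × Fin n => p.1 < p.2 ∧ w p.2 < w p.1)).card

/-- The number of cycles in the cycle decomposition of `w`,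
where fixed points count as cycles. -/
def numCycles {n : ℕ} (w : Equiv.Perm (Fin n)) : ℕ :=
  w.cycleType.card + (Finset.univ.filter (fun i : Fin n => w i = i)).card

/-- The reflection length of a permutation of `{1,…,n}`: `n` minus the number of
cycles in its cycle decomposition (fixed points counting as cycles). -/
def reflLen {n : ℕ} (w : Equiv.Perm (Fin n)) : ℕ :=
  n - numCycles w

/-- The total displacement `td(w) = Σ_i |w(i) - i|`. -/
def totalDisp {n : ℕ} (w : Equiv.Perm (Fin n)) : ℕ :=
  ∑ i : Fin n, ((w i : ℤ) - (i : ℤ)).natAbs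

/-- A permutation is shallow if `ℓ(w) + ℓ_T(w) = td(w)`. -/
def IsShallow {n : ℕ} (w : Equiv.Perm (Fin n)) : Prop :=
  invLen w + reflLen w = totalDisp w

/-- The `i`-th flattening of `w`: remove the `i`-th entry of the one-line notation
and renumber down by one every entry greater than `w i`.  Position `k` of `Fin n`
corresponds to position `i.succAbove k` of `Fin (n+1)`, and value `m` corresponds
to value `(w i).succAbove m`; this is implemented by deleting the point `i` from the
source and `w i` from the target via `finSuccEquiv'`. -/
def flatten {n : ℕ} (w : Equiv.Perm (Fin (n + 1))) (i : Fin (n + 1)) : Equiv.Perm (Fin n) :=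
  Equiv.removeNone ((finSuccEquiv' i).symm.trans (w.trans (finSuccEquiv' (w i))))

/-- `v` has a left-to-right maximum at position `j` if `v j > v i` for all `i < j`. -/
def LeftToRightMaxAt {m : ℕ} (v : Equiv.Perm (Fin m)) (j : Fin m) : Prop :=
  ∀ i : Fin m, i < j → v i < v j

/-- `v` has a right-to-left minimum at position `j` if `v j < v i` for all `i > j`. -/
def RightToLeftMinAt {m : ℕ} (v : Equiv.Perm (Fin m)) (j : Fin m) : Prop :=
  ∀ i : Fin m, j < i → v j < v i

open Equiv Equiv.Perm in
/-- Multiplying a permutation `w` by `swap x (w x)`, where `w x ≠ x`, splits `x` off its cycle, so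
that the number of cycles, fixed points included, goes up by one. -/
theorem card_cycleType_swap_mul_add {α : Type*} [Fintype α] [DecidableEq α] (w : Perm α) {x : α}
    (hx : w x ≠ x) :
    (swap x (w x) * w).cycleType.card + w.support.card =
      w.cycleType.card + (swap x (w x) * w).support.card + 1 := by
  have hmem : w.cycleOf x ∈ w.cycleFactorsFinset :=
    cycleOf_mem_cycleFactorsFinset_iff.2 (mem_support.2 hx)
  have hdisj : Perm.Disjoint (w.cycleOf x) (w * (w.cycleOf x)⁻¹) :=
    (disjoint_mul_inv_of_mem_cycleFactorsFinset hmem).symm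
  have hw : w = w.cycleOf x * (w * (w.cycleOf x)⁻¹) := by
    rw [hdisj.commute.eq]
    simp
  have hc : (w.cycleOf x).IsCycle := isCycle_cycleOf w hx
  have hcx : w x = w.cycleOf x x := (cycleOf_apply_self w x).symm
  generalize w.cycleOf x = c at hw hdisj hc hcx
  generalize w * c⁻¹ = d at hw hdisj
  rw [hcx] at hx ⊢
  subst hw
  rw [← mul_assoc, hdisj.cycleType_mul, hdisj.card_support_mul, hc.cycleType]
  by_cases h : c (c x) = x
  · have hs : swap x (c x) * c = 1 := by
      nth_rw 2 [hc.eq_swap_of_apply_apply_eq_self hx h]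
      exact swap_mul_self _ _
    have h2 : c.support.card = 2 := by
      rw [hc.eq_swap_of_apply_apply_eq_self hx h, card_support_swap hx.symm]
    simp [hs, h2]
    ring
  · have hsupp := support_swap_mul_eq c x h
    have hd : Perm.Disjoint (swap x (c x) * c) d := by
      rw [disjoint_iff_disjoint_support] at hdisj ⊢
      rw [hsupp]
      exact hdisj.mono_left Finset.sdiff_subset
    have hcard : (swap x (c x) * c).support.card + 1 = c.support.card := by
      rw [hsupp, Finset.sdiff_singleton_eq_erase,
        Finset.card_erase_add_one (mem_support.2 hx)]
    rw [hd.cycleType_mul, hd.card_support_mul, (hc.swap_mul hx h).cycleType]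
    simp
    omega

theorem numCycles_add_card_support {n : ℕ} (w : Equiv.Perm (Fin n)) :
    numCycles w + w.support.card = n + w.cycleType.card := by
  have h := Finset.card_filter_add_card_filter_not
    (s := (Finset.univ : Finset (Fin n))) (fun i => w i = i)
  rw [Finset.card_univ, Fintype.card_fin] at h
  have hs : w.support = Finset.univ.filter (fun i => ¬ w i = i) := rfl
  rw [numCycles, hs]
  omega

theorem numCycles_le {n : ℕ} (w : Equiv.Perm (Fin n)) : numCycles w ≤ n := by
  have h := Multiset.card_nsmul_le_sum (s := w.cycleType) (a := 1)
    fun _ hx => Equiv.Perm.one_lt_of_mem_cycleType hx |>.le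
  rw [Equiv.Perm.sum_cycleType, smul_eq_mul, mul_one] at h
  have := numCycles_add_card_support w
  omega

theorem succAbove_flatten {n : ℕ} (w : Equiv.Perm (Fin (n + 1))) (i : Fin (n + 1)) (k : Fin n) :
    (w i).succAbove (flatten w i k) = w (i.succAbove k) := by
  have hne : w (i.succAbove k) ≠ w i := fun h => i.succAbove_ne k (w.injective h)
  obtain ⟨m, hm⟩ := Fin.exists_succAbove_eq hne
  have h : ((finSuccEquiv' i).symm.trans (w.trans (finSuccEquiv' (w i)))) (some k) = some m := by
    simp [← hm]
  have h' := Equiv.removeNone_some _ ⟨m, h⟩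
  rw [h, Option.some_inj] at h'
  rw [← hm, flatten, h']

theorem swap_succAbove_of_near {n : ℕ} {i j : Fin (n + 1)}
    (h : ((j : ℤ) - (i : ℤ)).natAbs = 1) (m : Fin n) :
    Equiv.swap i j (j.succAbove m) = i.succAbove m := by
  simp only [Equiv.swap_apply_def, Fin.succAbove, Fin.ext_iff, Fin.lt_def]
  split_ifs <;> simp_all <;> omega

theorem extendDomain_flatten_of_near {n : ℕ} (w : Equiv.Perm (Fin (n + 1))) (i : Fin (n + 1))
    (hi : ((w i : ℤ) - (i : ℤ)).natAbs = 1) :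
    (flatten w i).extendDomain (finSuccAboveEquiv i) = Equiv.swap i (w i) * w := by
  ext1 x
  rcases Fin.eq_self_or_eq_succAbove i x with rfl | ⟨k, rfl⟩
  · rw [Equiv.Perm.extendDomain_apply_not_subtype _ _ (by simp)]
    simp
  · have h := Equiv.Perm.extendDomain_apply_image (flatten w i) (finSuccAboveEquiv i) k
    simp only [finSuccAboveEquiv_apply] at h
    rw [h, Equiv.Perm.mul_apply, ← succAbove_flatten, swap_succAbove_of_near hi]

theorem numCycles_flatten_of_near {n : ℕ} (w : Equiv.Perm (Fin (n + 1))) (i : Fin (n + 1))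
    (hi : ((w i : ℤ) - (i : ℤ)).natAbs = 1) : numCycles (flatten w i) = numCycles w := by
  have hwi : w i ≠ i := fun h => by simp [h] at hi
  have h := card_cycleType_swap_mul_add w hwi
  rw [← extendDomain_flatten_of_near w i hi, Equiv.Perm.cycleType_extendDomain,
    Equiv.Perm.card_support_extend_domain] at h
  have h₁ := numCycles_add_card_support w
  have h₂ := numCycles_add_card_support (flatten w i)
  omega

/-- If `|w i - i| = 1`, then reflection length decreases by exactly one under
flattening at `i`: `ℓ_T(fl_i(w)) = ℓ_T(w) - 1`. -/
theorem reflLen_flatten_of_near {n : ℕ} (w : Equiv.Perm (Fin (n + 1))) (i : Fin (n + 1))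
    (hi : ((w i : ℤ) - (i : ℤ)).natAbs = 1) :
    (reflLen (flatten w i) : ℤ) = (reflLen w : ℤ) - 1 := by
  have h := numCycles_flatten_of_near w i hi
  have hle := numCycles_le (flatten w i)
  rw [reflLen, reflLen]
  omega
end

section
/- Let n ≥ 2, let w' be a shallow permutation of {1,…,n−1}, and suppose w' has either a left-to-right maximum or a right-to-left minimum at position j. Let k = w'(j), and define the permutation w of {1,…,n} by w(i) = w'(i) for i ∈ {1,…,n−1} with i ≠ j, w(j) = n, and w(n) = k. Then w is shallow. -/
open Equiv in
/-- Multiplying by the transposition that detaches a moved point `x` from its cycle turns `x`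
into a fixed point; a nontrivial cycle disappears exactly when it had length two. -/
theorem card_cycleType_swap_mul {α : Type*} [Fintype α] [DecidableEq α] (f : Perm α) {x : α}
    (hx : f x ≠ x) :
    f.cycleType.card + (swap x (f x) * f).support.card + 1 =
      (swap x (f x) * f).cycleType.card + f.support.card := by
  set c := f.cycleOf x with hc
  set d := f * c⁻¹ with hd
  have hcyc : c.IsCycle := Perm.isCycle_cycleOf f hx
  have hcx : c x = f x := Perm.cycleOf_apply_self f x
  have hmem : c ∈ f.cycleFactorsFinset :=
    Perm.cycleOf_mem_cycleFactorsFinset_iff.2 (Perm.mem_support.2 hx)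
  have hdis : d.Disjoint c := Perm.disjoint_mul_inv_of_mem_cycleFactorsFinset hmem
  have hf : f = c * d := by rw [← hdis.commute.eq, hd]; simp
  have hfc : f.cycleType.card = 1 + d.cycleType.card := by
    conv_lhs => rw [hf, hdis.symm.cycleType_mul, hcyc.cycleType]
    simp [add_comm]
  have hfs : f.support.card = c.support.card + d.support.card := by
    conv_lhs => rw [hf, hdis.symm.card_support_mul]
  have hmul : swap x (f x) * f = (swap x (f x) * c) * d := by
    rw [mul_assoc, ← hf]
  rw [hmul, hfc, hfs]
  by_cases hffx : c (c x) = x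
  · have hcs : c = swap x (f x) := by
      rw [← hcx]
      exact hcyc.eq_swap_of_apply_apply_eq_self (by rwa [hcx]) hffx
    have h2 : c.support.card = 2 := by rw [hcs]; exact Perm.card_support_swap hx.symm
    rw [← hcs]
    have : c * c = 1 := by rw [hcs]; exact swap_mul_self _ _
    rw [this, one_mul, h2]
    omega
  · have hcyc' : (swap x (f x) * c).IsCycle := by
      rw [← hcx]
      exact hcyc.swap_mul (by rwa [hcx]) hffx
    have hsupp : (swap x (f x) * c).support = c.support \ {x} := by
      rw [← hcx]
      exact Perm.support_swap_mul_eq c x hffx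
    have hdis' : (swap x (f x) * c).Disjoint d := by
      rw [Perm.disjoint_iff_disjoint_support, hsupp]
      exact (Perm.disjoint_iff_disjoint_support.1 hdis.symm).mono_left Finset.sdiff_subset
    have hxc : x ∈ c.support := by rw [Perm.mem_support, hcx]; exact hx
    rw [hdis'.cycleType_mul, hdis'.card_support_mul, hcyc'.cycleType, hsupp,
      Finset.sdiff_singleton_eq_erase, Multiset.card_add, ← Finset.card_erase_add_one hxc]
    simp
    omega

theorem card_fixed_add_card_support {n : ℕ} (w : Equiv.Perm (Fin n)) :
    (Finset.univ.filter (fun i : Fin n => w i = i)).card + w.support.card = n := by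
  have h := Finset.card_filter_add_card_filter_not
    (s := (Finset.univ : Finset (Fin n))) (fun i => w i = i)
  rw [Finset.card_univ, Fintype.card_fin] at h
  exact h

theorem card_cycleType_le_card_support {α : Type*} [Fintype α] [DecidableEq α]
    (w : Equiv.Perm α) : w.cycleType.card ≤ w.support.card := by
  rw [← w.sum_cycleType]
  simpa using w.cycleType.card_nsmul_le_sum (a := 1)
    (fun i hi => (Equiv.Perm.one_lt_of_mem_cycleType hi).le)

theorem reflLen_add_card_cycleType {n : ℕ} (w : Equiv.Perm (Fin n)) :
    reflLen w + w.cycleType.card = w.support.card := by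
  have h₁ := card_fixed_add_card_support w
  have h₂ := card_cycleType_le_card_support w
  unfold reflLen numCycles
  omega

/-- Inserting the new point into the cycle of `j` raises the reflection length by one. -/
theorem reflLen_of_insertion {n : ℕ} (w' : Equiv.Perm (Fin n)) (j : Fin n)
    (w : Equiv.Perm (Fin (n + 1)))
    (hw : ∀ i : Fin n, i ≠ j → w i.castSucc = (w' i).castSucc)
    (hj : w j.castSucc = Fin.last n)
    (hlast : w (Fin.last n) = (w' j).castSucc) :
    reflLen w = reflLen w' + 1 := by
  have hx : w (Fin.last n) ≠ Fin.last n := by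
    rw [hlast]; exact (Fin.castSucc_lt_last _).ne
  have hext : Equiv.swap (Fin.last n) (w (Fin.last n)) * w =
      w'.extendDomain (finSuccAboveEquiv (Fin.last n)) := by
    ext i : 1
    refine Fin.lastCases ?_ (fun i => ?_) i
    · rw [Equiv.Perm.extendDomain_apply_not_subtype _ _ (by simp)]
      simp
    · have h := Equiv.Perm.extendDomain_apply_image w'
        (finSuccAboveEquiv (Fin.last n)) i
      simp only [finSuccAboveEquiv_apply, Fin.succAbove_last] at h
      rw [h, Equiv.Perm.mul_apply, hlast]
      by_cases hij : i = j
      · subst hij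
        rw [hj, Equiv.swap_apply_left]
      · rw [hw i hij, Equiv.swap_apply_of_ne_of_ne (Fin.castSucc_lt_last _).ne]
        simpa using hij
  have h := card_cycleType_swap_mul w hx
  rw [hext, Equiv.Perm.cycleType_extendDomain, Equiv.Perm.card_support_extend_domain] at h
  have h₁ := reflLen_add_card_cycleType w
  have h₂ := reflLen_add_card_cycleType w'
  omega

theorem invLen_eq_sum {n : ℕ} (w : Equiv.Perm (Fin n)) :
    invLen w = ∑ a, ∑ b, if a < b ∧ w b < w a then 1 else 0 := by
  rw [invLen, Finset.card_filter, Fintype.sum_prod_type]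

theorem invLen_of_insertion {n : ℕ} (w' : Equiv.Perm (Fin n)) (j : Fin n)
    (w : Equiv.Perm (Fin (n + 1)))
    (hw : ∀ i : Fin n, i ≠ j → w i.castSucc = (w' i).castSucc)
    (hj : w j.castSucc = Fin.last n)
    (hlast : w (Fin.last n) = (w' j).castSucc) :
    invLen w + (∑ a, if a < j ∧ w' j < w' a then 1 else 0) +
      (∑ b, if j < b ∧ w' b < w' j then 1 else 0) =
    invLen w' + (∑ b, if j < b then 1 else 0) + (∑ a, if w' j < w' a then 1 else 0) + 1 := by
  have hold : (∑ a : Fin n, ∑ b : Fin n,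
        if a < b ∧ w b.castSucc < w a.castSucc then 1 else 0) +
      (∑ a, if a < j ∧ w' j < w' a then 1 else 0) +
      (∑ b, if j < b ∧ w' b < w' j then 1 else 0) =
      invLen w' + ∑ b, if j < b then 1 else 0 := by
    have e₁ : (∑ a, if a < j ∧ w' j < w' a then 1 else 0) =
        ∑ a, ∑ b, if b = j then (if a < j ∧ w' j < w' a then 1 else 0) else 0 := by simp
    have e₂ (p : Fin n → Prop) [DecidablePred p] : (∑ b, if p b then 1 else 0) =
        ∑ a, ∑ b, if a = j then (if p b then 1 else 0) else 0 := by
      rw [Finset.sum_comm]; simp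
    rw [e₁, e₂ fun b => j < b ∧ w' b < w' j, e₂ fun b => j < b, invLen_eq_sum]
    simp only [← Finset.sum_add_distrib]
    refine Finset.sum_congr rfl fun a _ => Finset.sum_congr rfl fun b _ => ?_
    by_cases ha : a = j <;> by_cases hb : b = j
    · subst ha; subst hb; simp
    · subst ha
      have hlt := Fin.castSucc_lt_last (w' b)
      simp only [hw b hb, hj, hlt, hb]
      by_cases h : w' b < w' a <;> simp [h, add_comm]
    · subst hb
      simp [hw a ha, hj, ha, Fin.le_last]
    · simp [hw a ha, hw b hb, ha, hb]
  have hnew : (∑ a : Fin n, if w (Fin.last n) < w a.castSucc then 1 else 0) =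
      (∑ a, if w' j < w' a then 1 else 0) + 1 := by
    have e : (1 : ℕ) = ∑ a, if a = j then 1 else 0 := by simp
    conv_rhs => rw [e, ← Finset.sum_add_distrib]
    refine Finset.sum_congr rfl fun a _ => ?_
    by_cases ha : a = j
    · subst ha; simp [hj, hlast, Fin.castSucc_lt_last]
    · simp [hw a ha, hlast, ha]
  have hsplit : invLen w = (∑ a : Fin n, ∑ b : Fin n,
        if a < b ∧ w b.castSucc < w a.castSucc then 1 else 0) +
      ∑ a : Fin n, if w (Fin.last n) < w a.castSucc then 1 else 0 := by
    rw [invLen_eq_sum, Fin.sum_univ_castSucc]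
    simp only [Fin.sum_univ_castSucc, Finset.sum_add_distrib]
    simp [Fin.le_last]
  omega

theorem sum_ite_lt {n : ℕ} (j : Fin n) : (∑ b, if j < b then 1 else 0) = n - 1 - (j : ℕ) := by
  rw [← Finset.card_filter, ← Fin.card_Ioi]
  congr 1
  ext; simp

theorem sum_ite_apply_lt {n : ℕ} (w : Equiv.Perm (Fin n)) (j : Fin n) :
    (∑ a, if w j < w a then 1 else 0) = n - 1 - (w j : ℕ) := by
  rw [← sum_ite_lt, Equiv.sum_comp w fun v => if w j < v then 1 else 0]

/-- Larger values to the left of `j` and later positions, counted against smaller values to the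
right of `j` and larger values. -/
theorem sum_inv_left_add {n : ℕ} (w : Equiv.Perm (Fin n)) (j : Fin n) :
    (∑ a, if a < j ∧ w j < w a then 1 else 0) + (∑ b, if j < b then 1 else 0) =
      (∑ b, if j < b ∧ w b < w j then 1 else 0) + ∑ a, if w j < w a then 1 else 0 := by
  rw [← Finset.sum_add_distrib, ← Finset.sum_add_distrib]
  refine Finset.sum_congr rfl fun a _ => ?_
  rcases lt_trichotomy a j with h | h | h
  · simp [h, h.not_gt]
  · simp [h]
  · have hne : w a ≠ w j := w.injective.ne h.ne'
    rcases hne.lt_or_gt with h' | h' <;> simp [h, h.not_gt, h', h'.not_gt]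

theorem totalDisp_of_insertion {n : ℕ} (w' : Equiv.Perm (Fin n)) (j : Fin n)
    (w : Equiv.Perm (Fin (n + 1)))
    (hw : ∀ i : Fin n, i ≠ j → w i.castSucc = (w' i).castSucc)
    (hj : w j.castSucc = Fin.last n)
    (hlast : w (Fin.last n) = (w' j).castSucc) :
    totalDisp w + ((w' j : ℤ) - (j : ℤ)).natAbs =
      totalDisp w' + (n - (j : ℕ)) + (n - (w' j : ℕ)) := by
  have h₁ := Finset.add_sum_erase Finset.univ
    (fun i : Fin n => ((w i.castSucc : ℤ) - (i : ℤ)).natAbs) (Finset.mem_univ j)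
  have h₂ := Finset.add_sum_erase Finset.univ
    (fun i : Fin n => ((w' i : ℤ) - (i : ℤ)).natAbs) (Finset.mem_univ j)
  have h₃ : ∑ i ∈ Finset.univ.erase j, ((w i.castSucc : ℤ) - (i : ℤ)).natAbs =
      ∑ i ∈ Finset.univ.erase j, ((w' i : ℤ) - (i : ℤ)).natAbs :=
    Finset.sum_congr rfl fun i hi => by simp [hw i (Finset.ne_of_mem_erase hi)]
  unfold totalDisp
  rw [Fin.sum_univ_castSucc]
  simp only [hj, hlast, Fin.val_castSucc, Fin.val_last] at *
  have := j.isLt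
  have := (w' j).isLt
  omega

/-- Hadjicostas–Monico recursion (backward direction): if `w'` is a shallow permutation
of `{1,…,n-1}` with a left-to-right maximum or a right-to-left minimum at position `j`,
`k = w'(j)`, and `w` is the permutation of `{1,…,n}` agreeing with `w'` away from `j`
with `w(j) = n` and `w(n) = k`, then `w` is shallow. -/
theorem isShallow_of_insertion {n : ℕ} (hn : 1 ≤ n) (w' : Equiv.Perm (Fin n))
    (hs : IsShallow w') (j : Fin n)
    (hj : LeftToRightMaxAt w' j ∨ RightToLeftMinAt w' j)
    (w : Equiv.Perm (Fin (n + 1)))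
    (hagree : ∀ i : Fin n, i ≠ j → (w i.castSucc : ℕ) = (w' i : ℕ))
    (hj' : w j.castSucc = Fin.last n)
    (hlast : (w (Fin.last n) : ℕ) = (w' j : ℕ)) :
    IsShallow w := by
  have hw : ∀ i : Fin n, i ≠ j → w i.castSucc = (w' i).castSucc :=
    fun i hi => Fin.ext (hagree i hi)
  have hl : w (Fin.last n) = (w' j).castSucc := Fin.ext hlast
  have hrefl := reflLen_of_insertion w' j w hw hj' hl
  have hinv := invLen_of_insertion w' j w hw hj' hl
  have hdisp := totalDisp_of_insertion w' j w hw hj' hl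
  have hcount := sum_inv_left_add w' j
  rw [sum_ite_lt, sum_ite_apply_lt] at hinv hcount
  have hjn := j.isLt
  have hkn := (w' j).isLt
  unfold IsShallow at hs ⊢
  rcases hj with hmax | hmin
  · have h₀ : (∑ a, if a < j ∧ w' j < w' a then 1 else 0) = 0 :=
      Finset.sum_eq_zero fun a _ => if_neg fun h => (hmax a h.1).not_gt h.2
    rw [h₀] at hinv hcount
    omega
  · have h₀ : (∑ b, if j < b ∧ w' b < w' j then 1 else 0) = 0 :=
      Finset.sum_eq_zero fun b _ => if_neg fun h => (hmin b h.1).not_gt h.2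
    rw [h₀] at hinv hcount
    omega
end
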